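/- The Minkowski asymmetry does not satisfy Grünbaum's equality property (B) for Minkowski sums: there exist convex bodies K, L in E^n with s(K + L) = max{s(K), s(L)}, yet neither K nor L is centrally symmetric and K, L are not similar. Concretely, for a regular n-simplex T, the pseudo completion T^+ and any completion T* of T (with T^+ ≠ T*) satisfy s(T^+ + T*) = s(T^+) = s(T*). -/

import Mathlib

open Set Pointwise

/-- `V n` is `ℝ^n` (as a Euclidean space, also used as carrier for general
Minkowski spaces whose unit ball `B` is given as a set). -/
abbrev V (n : ℕ) := EuclideanSpace ℝ (Fin n)

/-- A convex body: compact, convex, with nonempty interior. -/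
def IsConvexBody {n : ℕ} (K : Set (V n)) : Prop :=
  Convex ℝ K ∧ IsCompact K ∧ (interior K).Nonempty

/-- A (centrally) symmetric unit ball of a norm. -/
def IsSymUnitBall {n : ℕ} (B : Set (V n)) : Prop :=
  IsConvexBody B ∧ B = -B

/-- Circumradius of `K` with respect to the unit ball `B`. -/
noncomputable def circum {n : ℕ} (B K : Set (V n)) : ℝ :=
  sInf {ρ : ℝ | 0 < ρ ∧ ∃ c : V n, K ⊆ c +ᵥ ρ • B}

/-- Inradius of `K` with respect to the unit ball `B`. -/
noncomputable def inrad {n : ℕ} (B K : Set (V n)) : ℝ :=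
  sSup {ρ : ℝ | 0 < ρ ∧ ∃ c : V n, c +ᵥ ρ • B ⊆ K}

/-- Diameter of `K` in the norm with unit ball `B` (via the Minkowski gauge). -/
noncomputable def mdiam {n : ℕ} (B K : Set (V n)) : ℝ :=
  sSup {d : ℝ | ∃ x ∈ K, ∃ y ∈ K, d = gauge B (x - y)}

/-- Minkowski asymmetry of `K`. -/
noncomputable def asym {n : ℕ} (K : Set (V n)) : ℝ :=
  sInf {ρ : ℝ | 0 < ρ ∧ ∃ c : V n, -K ⊆ c +ᵥ ρ • K}

/-- `K` is complete (diametrically maximal) w.r.t. the unit ball `B`. -/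
def IsCompleteBody {n : ℕ} (B K : Set (V n)) : Prop :=
  IsConvexBody K ∧ ∀ x : V n, x ∉ K → mdiam B K < mdiam B (K ∪ {x})

/-- `Kstar` is a completion of `K` w.r.t. the unit ball `B`. -/
def IsCompletionOf {n : ℕ} (B Kstar K : Set (V n)) : Prop :=
  IsCompleteBody B Kstar ∧ K ⊆ Kstar ∧ mdiam B Kstar = mdiam B K

/-- Jung ratio `R(K)/D(K)`. -/
noncomputable def jungRatio {n : ℕ} (B K : Set (V n)) : ℝ :=
  circum B K / mdiam B K

/-- Jung constant of the Minkowski space with unit ball `B`. -/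
noncomputable def jungConst {n : ℕ} (B : Set (V n)) : ℝ :=
  sSup {j : ℝ | ∃ K : Set (V n), IsConvexBody K ∧ j = jungRatio B K}

/-- Maximal Minkowski asymmetry over complete bodies. -/
noncomputable def asymConst {n : ℕ} (B : Set (V n)) : ℝ :=
  sSup {s : ℝ | ∃ K : Set (V n), IsCompleteBody B K ∧ s = asym K}

/-- Banach–Mazur distance between `K` and `C`. -/
noncomputable def dBM {n : ℕ} (K C : Set (V n)) : ℝ :=
  sInf {ρ : ℝ | 0 < ρ ∧ ∃ (A : (V n) ≃ᵃ[ℝ] (V n)) (x : V n),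
    K ⊆ A '' C ∧ A '' C ⊆ x +ᵥ ρ • K}

/-- `S` is a `k`-dimensional simplex. -/
def IsSimplexDim {n : ℕ} (k : ℕ) (S : Set (V n)) : Prop :=
  ∃ v : Fin (k + 1) → V n, AffineIndependent ℝ v ∧ S = convexHull ℝ (Set.range v)

/-- Helly property with parameter `k` for translates of `B`. -/
def HellyProp {n : ℕ} (B : Set (V n)) (k : ℕ) : Prop :=
  ∀ X : Set (V n), X.Nonempty →
    (∀ J : Finset (V n), ↑J ⊆ X → J.card ≤ k + 1 →
      (⋂ x ∈ (J : Set (V n)), (x +ᵥ B)).Nonempty) →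
    (⋂ x ∈ X, (x +ᵥ B)).Nonempty

/-- Helly dimension of `B`: the least positive `k` with the Helly property. -/
noncomputable def hellyDim {n : ℕ} (B : Set (V n)) : ℕ :=
  sInf {k : ℕ | 0 < k ∧ HellyProp B k}

/-- `K` is of constant width w.r.t. the unit ball `B`: `K - K` is a dilate of `B`. -/
def IsConstWidth {n : ℕ} (B K : Set (V n)) : Prop :=
  ∃ γ : ℝ, 0 < γ ∧ K - K = γ • B

/-- A regular `n`-simplex in Euclidean space. -/
def IsRegularSimplex {n : ℕ} (T : Set (V n)) : Prop :=
  ∃ v : Fin (n + 1) → V n, AffineIndependent ℝ v ∧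
    (∀ i j k l, i ≠ j → k ≠ l → dist (v i) (v j) = dist (v k) (v l)) ∧
    T = convexHull ℝ (Set.range v)

/-- The Euclidean unit ball in `ℝ^n`. -/
noncomputable def euclBall (n : ℕ) : Set (V n) := Metric.closedBall 0 1

/-- Pseudo completion of `K` with respect to the circumcenter `c`. -/
noncomputable def pseudoCompletion {n : ℕ} (B K : Set (V n)) (c : V n) : Set (V n) :=
  convexHull ℝ (K ∪ (c +ᵥ (mdiam B K - circum B K) • B))

theorem vadd_smul_euclBall {n : ℕ} (c : V n) {ρ : ℝ} (hρ : 0 ≤ ρ) :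
    c +ᵥ ρ • euclBall n = Metric.closedBall c ρ := by
  rw [euclBall, smul_unitClosedBall_of_nonneg hρ, vadd_closedBall_zero]

theorem gauge_euclBall {n : ℕ} (x : V n) : gauge (euclBall n) x = ‖x‖ := by
  rw [euclBall, gauge_closedBall zero_le_one, div_one]

/-- `K` lies between the concentric balls of radii `r` and `R` about `c`, touches the outer sphere
at the points `c + u i`, and lies in the half-spaces touching the inner sphere opposite to them. -/
structure IsSandwiched {n : ℕ} {ι : Type*} (u : ι → V n) (r R : ℝ) (c : V n)
    (K : Set (V n)) : Prop where
  ball_subset : Metric.closedBall c r ⊆ K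
  subset_ball : K ⊆ Metric.closedBall c R
  mem : ∀ i, c + u i ∈ K
  le_inner : ∀ x ∈ K, ∀ i, -(r * R) ≤ inner ℝ (x - c) (u i)

namespace IsSandwiched

variable {n : ℕ} {ι : Type*} {u : ι → V n} {r R : ℝ} {c d : V n} {K L : Set (V n)}

theorem add (hK : IsSandwiched u r R c K) (hL : IsSandwiched u r R d L) :
    IsSandwiched (fun i => (2 : ℝ) • u i) (2 * r) (2 * R) (c + d) (K + L) where
  ball_subset := by
    intro x hx
    rw [mem_closedBall_iff_norm] at hx
    have hmem : ∀ e : V n, e + (1 / 2 : ℝ) • (x - (c + d)) ∈ Metric.closedBall e r := by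
      intro e
      rw [mem_closedBall_iff_norm, add_sub_cancel_left, norm_smul]
      norm_num
      linarith
    refine ⟨_, hK.ball_subset (hmem c), _, hL.ball_subset (hmem d), ?_⟩
    module
  subset_ball := by
    rintro _ ⟨x, hx, y, hy, rfl⟩
    have h1 := mem_closedBall_iff_norm.1 (hK.subset_ball hx)
    have h2 := mem_closedBall_iff_norm.1 (hL.subset_ball hy)
    rw [mem_closedBall_iff_norm]
    calc ‖x + y - (c + d)‖ = ‖(x - c) + (y - d)‖ := by congr 1; abel
      _ ≤ ‖x - c‖ + ‖y - d‖ := norm_add_le _ _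
      _ ≤ 2 * R := by linarith
  mem i := ⟨_, hK.mem i, _, hL.mem i, by module⟩
  le_inner := by
    rintro _ ⟨x, hx, y, hy, rfl⟩ i
    have h1 := hK.le_inner x hx i
    have h2 := hL.le_inner y hy i
    have h3 : x + y - (c + d) = (x - c) + (y - d) := by abel
    simp only [h3, inner_add_left, inner_smul_right]
    linarith

theorem asym_eq [Fintype ι] [Nonempty ι] (h : IsSandwiched u r R c K) (hr : 0 < r) (hR : 0 < R)
    (hsum : ∑ i, u i = 0) (hu : ∀ i, ‖u i‖ = R) : asym K = R / r := by
  have hdiv : 0 < R / r := div_pos hR hr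
  refine IsLeast.csInf_eq ⟨⟨hdiv, -c - (R / r) • c, ?_⟩, ?_⟩
  · intro x hx
    have hx' := mem_closedBall_iff_norm.1 (h.subset_ball (Set.mem_neg.1 hx))
    rw [Set.mem_vadd_set]
    refine ⟨(R / r) • (c + (r / R) • (x + c)), Set.smul_mem_smul_set (h.ball_subset ?_), ?_⟩
    · rw [mem_closedBall_iff_norm, add_sub_cancel_left, norm_smul,
        Real.norm_of_nonneg (div_pos hr hR).le]
      have h1 : ‖x + c‖ ≤ R := by
        rwa [← norm_neg, neg_add']
      calc r / R * ‖x + c‖ ≤ r / R * R := by gcongr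
        _ = r := by field_simp
    · have h1 : R / r * (r / R) = 1 := by field_simp
      rw [vadd_eq_add, smul_add, smul_smul, h1]
      module
  · rintro ρ ⟨hρ, d, hd⟩
    have key : ∀ i, R ^ 2 + inner ℝ (c + d + ρ • c) (u i) ≤ ρ * (r * R) := by
      intro i
      obtain ⟨_, ⟨k, hk, rfl⟩, hke⟩ := hd (Set.neg_mem_neg.2 (h.mem i))
      have h1 := mul_le_mul_of_nonneg_left (h.le_inner k hk i) hρ.le
      have h2 : c + d + ρ • c = -u i - ρ • (k - c) := by
        simp only [vadd_eq_add] at hke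
        rw [eq_comm, neg_eq_iff_eq_neg] at hke
        have h3 : u i = -(d + ρ • k) - c := by rw [← hke]; abel
        rw [h3]
        module
      rw [h2, inner_sub_left, inner_neg_left, real_inner_self_eq_norm_sq, hu, inner_smul_left]
      simp only [conj_trivial]
      linarith
    have hs := Finset.sum_le_sum fun i (_ : i ∈ Finset.univ) => key i
    rw [Finset.sum_add_distrib, ← inner_sum, hsum, inner_zero_right] at hs
    simp only [Finset.sum_const, Finset.card_univ, nsmul_eq_mul, add_zero] at hs
    have hcard : (0 : ℝ) < Fintype.card ι := by exact_mod_cast Fintype.card_pos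
    have h4 : R ^ 2 ≤ ρ * (r * R) := le_of_mul_le_mul_left hs hcard
    rw [div_le_iff₀ hr]
    nlinarith

theorem asym_add [Fintype ι] [Nonempty ι] (hK : IsSandwiched u r R c K)
    (hL : IsSandwiched u r R d L) (hr : 0 < r) (hR : 0 < R)
    (hsum : ∑ i, u i = 0) (hu : ∀ i, ‖u i‖ = R) : asym (K + L) = R / r := by
  rw [(hK.add hL).asym_eq (by positivity) (by positivity) (by rw [← Finset.smul_sum, hsum,
    smul_zero]) (fun i => by rw [norm_smul, hu]; norm_num), mul_div_mul_left _ _ two_ne_zero]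

theorem not_symmetric [Fintype ι] [Nonempty ι] (h : IsSandwiched u r R c K) (hr : 0 < r)
    (hrR : r < R) (hsum : ∑ i, u i = 0) (hu : ∀ i, ‖u i‖ = R) : ¬ ∃ x : V n, -K = x +ᵥ K := by
  rintro ⟨x, hx⟩
  have h1 : asym K ≤ 1 :=
    csInf_le ⟨0, fun _ hρ => hρ.1.le⟩ ⟨one_pos, x, by rw [one_smul, hx]⟩
  rw [h.asym_eq hr (hr.trans hrR) hsum hu, div_le_one hr] at h1
  linarith

/-- Bound on the ratio and the translation of a similar copy of `K` inside the outer ball. -/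
theorem norm_sq_add_le [Fintype ι] [Nonempty ι] (hK : IsSandwiched u r R 0 K)
    (hsum : ∑ i, u i = 0) (hu : ∀ i, ‖u i‖ = R) {x : V n} {ρ : ℝ}
    (hsub : x +ᵥ ρ • K ⊆ Metric.closedBall 0 R) : ‖x‖ ^ 2 + ρ ^ 2 * R ^ 2 ≤ R ^ 2 := by
  have key : ∀ i, ‖x‖ ^ 2 + ρ ^ 2 * R ^ 2 + 2 * ρ * inner ℝ x (u i) ≤ R ^ 2 := by
    intro i
    have h1 : x + ρ • u i ∈ Metric.closedBall (0 : V n) R :=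
      hsub ⟨_, ⟨_, hK.mem i, rfl⟩, by simp⟩
    rw [mem_closedBall_zero_iff] at h1
    have h2 := pow_le_pow_left₀ (norm_nonneg _) h1 2
    rw [norm_add_sq_real, norm_smul, inner_smul_right, hu, mul_pow, Real.norm_eq_abs, sq_abs] at h2
    linarith
  have hs := Finset.sum_le_sum fun i (_ : i ∈ Finset.univ) => key i
  rw [Finset.sum_add_distrib, ← Finset.mul_sum, ← inner_sum, hsum, inner_zero_right] at hs
  simp only [Finset.sum_const, Finset.card_univ, nsmul_eq_mul, mul_zero, add_zero] at hs
  exact le_of_mul_le_mul_left hs (by exact_mod_cast Fintype.card_pos)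

theorem eq_of_similar [Fintype ι] [Nonempty ι] (hK : IsSandwiched u r R 0 K)
    (hL : IsSandwiched u r R 0 L) (hR : 0 < R) (hsum : ∑ i, u i = 0) (hu : ∀ i, ‖u i‖ = R)
    {ρ : ℝ} {x : V n} (hρ : 0 < ρ) (h : L = x +ᵥ ρ • K) : L = K := by
  have h1 := hK.norm_sq_add_le hsum hu (h ▸ hL.subset_ball)
  have hinv : K = (-(ρ⁻¹ • x)) +ᵥ ρ⁻¹ • L := by
    ext y
    rw [h]
    simp only [Set.mem_vadd_set, Set.mem_smul_set, vadd_eq_add]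
    constructor
    · intro hy
      refine ⟨_, ⟨_, ⟨_, ⟨y, hy, rfl⟩, rfl⟩, rfl⟩, ?_⟩
      rw [smul_add, smul_smul, inv_mul_cancel₀ hρ.ne']
      module
    · rintro ⟨_, ⟨_, ⟨_, ⟨z, hz, rfl⟩, rfl⟩, rfl⟩, rfl⟩
      rw [smul_add, smul_smul, inv_mul_cancel₀ hρ.ne']
      convert hz using 1
      module
  have h2 := hL.norm_sq_add_le hsum hu (hinv ▸ hK.subset_ball)
  have hR2 : 0 < R ^ 2 := by positivity
  have h3 : ρ ≤ 1 := (sq_le_one_iff₀ hρ.le).1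
    (le_of_mul_le_mul_right (by linarith [sq_nonneg ‖x‖]) hR2)
  have h4 : ρ⁻¹ ≤ 1 := (sq_le_one_iff₀ (inv_pos.2 hρ).le).1
    (le_of_mul_le_mul_right (by linarith [sq_nonneg ‖-(ρ⁻¹ • x)‖]) hR2)
  have h5 : ρ = 1 := le_antisymm h3 ((inv_le_one₀ hρ).1 h4)
  subst h5
  have h6 : x = 0 := by
    rw [← norm_eq_zero, ← sq_eq_zero_iff]
    nlinarith [sq_nonneg ‖x‖]
  rw [h, h6, one_smul, zero_vadd]

end IsSandwiched

/-- The part of the unit ball cut off by the half-spaces `-r ≤ ⟪x, a⟫` for `a ∈ S`. -/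
def cappedBall {n : ℕ} (S : Set (V n)) (r : ℝ) : Set (V n) :=
  Metric.closedBall 0 1 ∩ ⋂ a ∈ S, {x | -r ≤ inner ℝ x a}

theorem mem_cappedBall {n : ℕ} {S : Set (V n)} {r : ℝ} {x : V n} :
    x ∈ cappedBall S r ↔ ‖x‖ ≤ 1 ∧ ∀ a ∈ S, -r ≤ inner ℝ x a := by
  simp [cappedBall]

theorem closedBall_subset_cappedBall {n : ℕ} {S : Set (V n)} {r : ℝ} (hr : r ≤ 1)
    (hS : ∀ a ∈ S, ‖a‖ = 1) : Metric.closedBall 0 r ⊆ cappedBall S r := by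
  intro x hx
  rw [mem_closedBall_zero_iff] at hx
  refine mem_cappedBall.2 ⟨hx.trans hr, fun a ha => ?_⟩
  have h1 := abs_real_inner_le_norm x a
  rw [hS a ha, mul_one] at h1
  linarith [(abs_le.1 h1).1]

theorem isConvexBody_cappedBall {n : ℕ} {S : Set (V n)} {r : ℝ} (hr0 : 0 < r) (hr : r ≤ 1)
    (hS : ∀ a ∈ S, ‖a‖ = 1) : IsConvexBody (cappedBall S r) := by
  refine ⟨(convex_closedBall _ _).inter (convex_iInter₂ fun a _ => ?_),
    (isCompact_closedBall _ _).inter_right (isClosed_biInter fun a _ => ?_), 0, ?_⟩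
  · intro x hx y hy s t hs ht hst
    simp only [Set.mem_ofPred_eq, inner_add_left, inner_smul_left, conj_trivial] at *
    nlinarith
  · exact isClosed_le continuous_const (by fun_prop)
  · rw [mem_interior_iff_mem_nhds]
    exact Filter.mem_of_superset (Metric.closedBall_mem_nhds _ hr0)
      (closedBall_subset_cappedBall hr hS)

theorem isSandwiched_cappedBall {n : ℕ} {ι : Type*} {u : ι → V n} {S : Set (V n)} {r : ℝ}
    (hr : r ≤ 1) (hS : ∀ a ∈ S, ‖a‖ = 1) (huS : ∀ i, u i ∈ S)
    (hin : ∀ i, ∀ a ∈ S, -r ≤ inner ℝ (u i) a) : IsSandwiched u r 1 0 (cappedBall S r) where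
  ball_subset := closedBall_subset_cappedBall hr hS
  subset_ball := Set.inter_subset_left
  mem i := by
    rw [zero_add]
    exact mem_cappedBall.2 ⟨(hS _ (huS i)).le, hin i⟩
  le_inner x hx i := by
    rw [mul_one, sub_zero]
    exact (mem_cappedBall.1 hx).2 _ (huS i)

theorem exists_asym_add_eq_max {n : ℕ} (hn : 2 ≤ n) :
    ∃ K L : Set (V n), IsConvexBody K ∧ IsConvexBody L ∧
      asym (K + L) = max (asym K) (asym L) ∧
      ¬(∃ c : V n, -K = c +ᵥ K) ∧ ¬(∃ c : V n, -L = c +ᵥ L) ∧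
      ¬(∃ (ρ : ℝ) (x : V n), 0 < ρ ∧ L = x +ᵥ ρ • K) := by
  obtain ⟨e, f, hee, hff, hef⟩ : ∃ e f : V n, ‖e‖ = 1 ∧ ‖f‖ = 1 ∧
      inner ℝ e f = (0 : ℝ) := by
    have ho := (EuclideanSpace.basisFun (Fin n) ℝ).orthonormal
    refine ⟨EuclideanSpace.basisFun (Fin n) ℝ ⟨0, by omega⟩,
      EuclideanSpace.basisFun (Fin n) ℝ ⟨1, by omega⟩, ho.1 _, ho.1 _, ho.2 (by simp)⟩
  have hfe : inner ℝ f e = (0 : ℝ) := by rw [real_inner_comm, hef]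
  have h3 : √3 * √3 = (3 : ℝ) := Real.mul_self_sqrt (by norm_num)
  have h3' : √3 < (9 / 5 : ℝ) := by
    rw [Real.sqrt_lt' (by norm_num)]
    norm_num
  let u : Fin 3 → V n := ![e, (-1 / 2 : ℝ) • e + (√3 / 2) • f, (-1 / 2 : ℝ) • e - (√3 / 2) • f]
  have hu : ∀ i, ‖u i‖ = 1 := by
    intro i
    rw [← sq_eq_sq₀ (norm_nonneg _) zero_le_one, ← real_inner_self_eq_norm_sq]
    fin_cases i <;>
      simp [u, -inner_self_eq_norm_sq_to_K, real_inner_self_eq_norm_sq, inner_add_left, inner_add_right, inner_sub_left, inner_sub_right, inner_smul_left,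
        inner_smul_right, hee, hff, hef, hfe] <;> nlinarith
  have hsum : ∑ i, u i = 0 := by
    simp only [Fin.sum_univ_three, u, Matrix.cons_val_zero, Matrix.cons_val_one, Matrix.cons_val]
    module
  have huu : ∀ i j, -(9 / 10 : ℝ) ≤ inner ℝ (u i) (u j) := by
    intro i j
    fin_cases i <;> fin_cases j <;>
      simp [u, inner_add_left, inner_add_right, inner_sub_left, inner_sub_right, inner_smul_left,
        inner_smul_right, hee, hff, hef, hfe] <;> nlinarith
  have hfu : ∀ i, |inner ℝ f (u i)| ≤ (9 / 10 : ℝ) := by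
    intro i
    rw [abs_le]
    fin_cases i <;> constructor <;>
      simp [u, inner_add_right, inner_sub_right, inner_smul_right, hff, hfe] <;> nlinarith
  have hS : ∀ a ∈ Set.range u, ‖a‖ = 1 := by
    rintro _ ⟨i, rfl⟩
    exact hu i
  have hS' : ∀ a ∈ insert (-f) (Set.range u), ‖a‖ = 1 := by
    rintro a (rfl | ha)
    · rw [norm_neg, hff]
    · exact hS a ha
  have hK : IsSandwiched u (9 / 10) 1 0 (cappedBall (insert (-f) (Set.range u)) (9 / 10)) := by
    refine isSandwiched_cappedBall (by norm_num) hS' (fun i => Or.inr ⟨i, rfl⟩) ?_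
    rintro i a (rfl | ⟨j, rfl⟩)
    · rw [inner_neg_right, real_inner_comm]
      linarith [(abs_le.1 (hfu i)).2]
    · exact huu i j
  have hL : IsSandwiched u (9 / 10) 1 0 (cappedBall (Set.range u) (9 / 10)) := by
    refine isSandwiched_cappedBall (by norm_num) hS (fun i => ⟨i, rfl⟩) ?_
    rintro i a ⟨j, rfl⟩
    exact huu i j
  have hr : (0 : ℝ) < 9 / 10 := by norm_num
  refine ⟨_, _, isConvexBody_cappedBall hr (by norm_num) hS',
    isConvexBody_cappedBall hr (by norm_num) hS, ?_,
    hK.not_symmetric hr (by norm_num) hsum hu, hL.not_symmetric hr (by norm_num) hsum hu, ?_⟩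
  · rw [hK.asym_add hL hr one_pos hsum hu, hK.asym_eq hr one_pos hsum hu,
      hL.asym_eq hr one_pos hsum hu, max_self]
  · rintro ⟨ρ, x, hρ, h⟩
    have hfL : f ∈ cappedBall (Set.range u) (9 / 10) := by
      refine mem_cappedBall.2 ⟨hff.le, ?_⟩
      rintro _ ⟨i, rfl⟩
      exact (abs_le.1 (hfu i)).1
    rw [hK.eq_of_similar hL one_pos hsum hu hρ h] at hfL
    have h1 := (mem_cappedBall.1 hfL).2 (-f) (Or.inl rfl)
    rw [inner_neg_right, real_inner_self_eq_norm_sq, hff] at h1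
    norm_num at h1

/-- The vectors `u i` from the centroid of a regular simplex to its vertices, together with its
circumradius `R` and its edge length `D`. -/
structure IsRegularFrame {n : ℕ} (u : Fin (n + 1) → V n) (R D : ℝ) : Prop where
  R_pos : 0 < R
  D_pos : 0 < D
  sum_eq : ∑ i, u i = 0
  norm_eq : ∀ i, ‖u i‖ = R
  norm_sub : ∀ i j, i ≠ j → ‖u i - u j‖ = D
  mul_sq : n * D ^ 2 = 2 * (n + 1) * R ^ 2
  span : ∀ y : V n, ∃ w : Fin (n + 1) → ℝ, ∑ i, w i = 1 ∧ y = ∑ i, w i • u i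

theorem IsRegularSimplex.exists_frame {n : ℕ} (hn : 2 ≤ n) {T : Set (V n)}
    (hT : IsRegularSimplex T) : ∃ (g : V n) (u : Fin (n + 1) → V n) (R D : ℝ),
      IsRegularFrame u R D ∧ T = convexHull ℝ (Set.range fun i => g + u i) := by
  obtain ⟨v, hv, hd, rfl⟩ := hT
  have h01 : (0 : Fin (n + 1)) ≠ Fin.last n := by
    intro h
    have := congrArg Fin.val h
    simp at this
    omega
  set D := dist (v 0) (v (Fin.last n)) with hD
  have hDpos : 0 < D := dist_pos.2 (hv.injective.ne h01)
  set g : V n := ((n : ℝ) + 1)⁻¹ • ∑ i, v i with hg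
  set u : Fin (n + 1) → V n := fun i => v i - g with hu
  have hsum : ∑ i, u i = 0 := by
    simp only [hu, Finset.sum_sub_distrib, Finset.sum_const, Finset.card_univ, Fintype.card_fin]
    rw [← Nat.cast_smul_eq_nsmul ℝ, hg, smul_smul]
    push_cast
    rw [mul_inv_cancel₀ (by positivity), one_smul, sub_self]
  have hsub : ∀ i j, i ≠ j → ‖u i - u j‖ = D := by
    intro i j hij
    rw [hD, ← hd i j 0 (Fin.last n) hij h01, dist_eq_norm]
    simp [hu]
  set S := ∑ i, ‖u i‖ ^ 2 with hS
  have hrow : ∀ i, n * D ^ 2 = (n + 1) * ‖u i‖ ^ 2 + S := by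
    intro i
    have h1 : ∑ j, ‖u i - u j‖ ^ 2 = n * D ^ 2 := by
      rw [← Finset.sum_erase_add _ _ (Finset.mem_univ i), Finset.sum_congr rfl
        (g := fun _ => D ^ 2) (fun j hj => by rw [hsub i j (Finset.ne_of_mem_erase hj).symm])]
      simp
    rw [← h1]
    simp only [norm_sub_sq_real, Finset.sum_add_distrib, Finset.sum_sub_distrib,
      ← Finset.mul_sum, ← inner_sum, hsum]
    simp [hS]
  have hS2 : 2 * S = n * D ^ 2 := by
    have h1 := Finset.sum_congr rfl fun i (_ : i ∈ Finset.univ) => hrow i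
    simp only [Finset.sum_add_distrib, ← Finset.mul_sum, ← hS, Finset.sum_const, Finset.card_univ, Fintype.card_fin, nsmul_eq_mul] at h1
    push_cast at h1
    have h2 : ((n : ℝ) + 1) ≠ 0 := by positivity
    apply mul_left_cancel₀ h2
    linarith
  have hnorm : ∀ i, ‖u i‖ = ‖u 0‖ := by
    intro i
    rw [← sq_eq_sq₀ (norm_nonneg _) (norm_nonneg _)]
    have h2 : ((n : ℝ) + 1) ≠ 0 := by positivity
    apply mul_left_cancel₀ h2
    linarith [hrow i, hrow 0]
  have hmul : n * D ^ 2 = 2 * (n + 1) * ‖u 0‖ ^ 2 := by linarith [hrow 0]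
  refine ⟨g, u, ‖u 0‖, D, ⟨?_, hDpos, hsum, hnorm, hsub, hmul, ?_⟩, ?_⟩
  · refine lt_of_le_of_ne (norm_nonneg _) fun h => ?_
    rw [← h] at hmul
    have : 0 < n * D ^ 2 := by positivity
    norm_num at hmul
    rcases hmul with h | h
    · omega
    · exact hDpos.ne' h
  · intro y
    have htop : affineSpan ℝ (Set.range v) = ⊤ := by
      rw [hv.affineSpan_eq_top_iff_card_eq_finrank_add_one]
      simp
    have hy : y + g ∈ affineSpan ℝ (Set.range v) := by rw [htop]; trivial
    obtain ⟨w, hw, hyw⟩ := eq_affineCombination_of_mem_affineSpan_of_fintype hy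
    refine ⟨w, hw, ?_⟩
    rw [Finset.affineCombination_eq_linear_combination _ _ _ hw] at hyw
    simp only [hu, smul_sub, Finset.sum_sub_distrib, ← Finset.sum_smul, hw, one_smul, ← hyw]
    abel
  · simp [hu]

namespace IsRegularFrame

variable {n : ℕ} {u : Fin (n + 1) → V n} {R D : ℝ}

theorem inner_eq (h : IsRegularFrame u R D) (i j : Fin (n + 1)) :
    n * inner ℝ (u i) (u j) = (n + 1) * R ^ 2 * (if i = j then 1 else 0) - R ^ 2 := by
  split_ifs with hij
  · subst hij
    rw [real_inner_self_eq_norm_sq, h.norm_eq]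
    ring
  · have h1 := norm_sub_sq_real (u i) (u j)
    rw [h.norm_sub i j hij, h.norm_eq, h.norm_eq] at h1
    have h2 := h.mul_sq
    rw [h1] at h2
    linarith

theorem sum_inner_sq (h : IsRegularFrame u R D) (y : V n) :
    n * ∑ i, inner ℝ y (u i) ^ 2 = (n + 1) * R ^ 2 * ‖y‖ ^ 2 := by
  obtain ⟨w, hw, rfl⟩ := h.span y
  set y := ∑ i, w i • u i with hy
  have h1 : ∀ i, n * inner ℝ y (u i) = (n + 1) * R ^ 2 * w i - R ^ 2 := by
    intro i
    rw [hy, sum_inner, Finset.mul_sum]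
    calc ∑ j, n * inner ℝ (w j • u j) (u i)
        = ∑ j, ((n + 1) * R ^ 2 * (if j = i then w j else 0) - R ^ 2 * w j) := by
          refine Finset.sum_congr rfl fun j _ => ?_
          rw [inner_smul_left, conj_trivial, mul_left_comm, h.inner_eq]
          split_ifs <;> ring
      _ = _ := by
          rw [Finset.sum_sub_distrib, ← Finset.mul_sum, ← Finset.mul_sum, hw]
          simp
  have h2 : ∑ i, w i * inner ℝ y (u i) = ‖y‖ ^ 2 := by
    rw [← real_inner_self_eq_norm_sq]
    conv_rhs => rw [hy, inner_sum]
    simp only [inner_smul_right, ← hy]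
  calc n * ∑ i, inner ℝ y (u i) ^ 2
      = ∑ i, ((n + 1) * R ^ 2 * (w i * inner ℝ y (u i)) - R ^ 2 * inner ℝ y (u i)) := by
        rw [Finset.mul_sum]
        refine Finset.sum_congr rfl fun i _ => ?_
        linear_combination inner ℝ y (u i) * h1 i
    _ = _ := by
        rw [Finset.sum_sub_distrib, ← Finset.mul_sum, ← Finset.mul_sum, h2, ← inner_sum, h.sum_eq,
          inner_zero_right, mul_zero, sub_zero]

theorem norm_le (h : IsRegularFrame u R D) (hn : 0 < n) {y : V n}
    (hy : ∀ i, ‖y - u i‖ ≤ D) : ‖y‖ ≤ R := by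
  by_contra! hlt
  have hR := h.R_pos
  have hn' : (0 : ℝ) < n := by exact_mod_cast hn
  have hy0 : 0 < ‖y‖ := hR.trans hlt
  set b := (‖y‖ ^ 2 + R ^ 2 - D ^ 2) / 2 with hb
  have hlow : ∀ i, b - inner ℝ y (u i) ≤ 0 := by
    intro i
    have h1 := pow_le_pow_left₀ (norm_nonneg _) (hy i) 2
    rw [norm_sub_sq_real, h.norm_eq] at h1
    linarith
  have hup : ∀ i, inner ℝ y (u i) - ‖y‖ * R ≤ 0 := by
    intro i
    have h1 := real_inner_le_norm y (u i)
    rw [h.norm_eq] at h1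
    linarith
  have hs := Finset.sum_nonneg fun i (_ : i ∈ Finset.univ) =>
    mul_nonneg_of_nonpos_of_nonpos (hlow i) (hup i)
  have hexp : ∀ i, (b - inner ℝ y (u i)) * (inner ℝ y (u i) - ‖y‖ * R) =
      (b + ‖y‖ * R) * inner ℝ y (u i) - inner ℝ y (u i) ^ 2 - b * (‖y‖ * R) := fun i => by ring
  simp only [hexp, Finset.sum_sub_distrib, ← Finset.mul_sum, ← inner_sum, h.sum_eq,
    inner_zero_right, Finset.sum_const, Finset.card_univ, Fintype.card_fin, nsmul_eq_mul] at hs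
  push_cast at hs
  have h1 := mul_nonneg hn'.le hs
  have h2 : 0 ≤ -(((n : ℝ) + 1) * R * ‖y‖ * (R * ‖y‖ + n * b)) := by
    linarith [h.sum_inner_sq y]
  have h3 : R * ‖y‖ + n * b ≤ 0 := by
    have hpos : 0 < ((n : ℝ) + 1) * R * ‖y‖ := by positivity
    by_contra! hc
    linarith [mul_pos hpos hc]
  have h4 : R * ‖y‖ + n * b = ((‖y‖ - R) * (n * (‖y‖ + R) + 2 * R)) / 2 := by
    rw [hb]
    linear_combination (-1 / 2) * h.mul_sq
  rw [h4] at h3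
  have h5 : 0 < (‖y‖ - R) * (n * (‖y‖ + R) + 2 * R) := mul_pos (by linarith) (by positivity)
  linarith

theorem R_lt_D (h : IsRegularFrame u R D) (hn : 2 ≤ n) : R < D := by
  have hR := h.R_pos
  have hD := h.D_pos
  have hn' : (2 : ℝ) ≤ n := by exact_mod_cast hn
  by_contra! hlt
  have h1 : n * D ^ 2 ≤ n * R ^ 2 := by gcongr
  nlinarith [h.mul_sq, pow_pos hR 2]

theorem D_sub_R_le (h : IsRegularFrame u R D) (hn : 2 ≤ n) : D - R ≤ R := by
  have hR := h.R_pos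
  have hn' : (2 : ℝ) ≤ n := by exact_mod_cast hn
  by_contra! hlt
  have h1 : n * (2 * R) ^ 2 ≤ n * D ^ 2 := by
    gcongr
    linarith
  nlinarith [h.mul_sq, pow_pos hR 2]

theorem R_le_mul (h : IsRegularFrame u R D) (hn : 2 ≤ n) : R ≤ n * (D - R) := by
  have hR := h.R_pos
  have hD := h.D_pos
  have hn' : (2 : ℝ) ≤ n := by exact_mod_cast hn
  by_contra! hlt
  have h1 : n * D < (n + 1) * R := by linarith
  have h2 : (n * D) ^ 2 < ((n + 1) * R) ^ 2 := by gcongr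
  have h3 : (n * D) ^ 2 = n * (2 * (n + 1) * R ^ 2) := by rw [← h.mul_sq]; ring
  have h4 : 0 ≤ (n - 1) * ((n + 1) * R ^ 2) := mul_nonneg (by linarith) (by positivity)
  nlinarith

theorem sq_add_le (h : IsRegularFrame u R D) {g c : V n} {ρ : ℝ}
    (hsub : convexHull ℝ (Set.range fun i => g + u i) ⊆ Metric.closedBall c ρ) :
    R ^ 2 + ‖g - c‖ ^ 2 ≤ ρ ^ 2 := by
  have hx : ∀ i, ‖(g - c) + u i‖ ≤ ρ := fun i => by
    rw [sub_add_eq_add_sub]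
    exact mem_closedBall_iff_norm.1 (hsub (subset_convexHull ℝ _ ⟨i, rfl⟩))
  have hs := Finset.sum_le_sum fun i (_ : i ∈ Finset.univ) =>
    pow_le_pow_left₀ (norm_nonneg _) (hx i) 2
  simp only [norm_add_sq_real, h.norm_eq, Finset.sum_add_distrib, ← Finset.mul_sum, ← inner_sum,
    h.sum_eq, inner_zero_right, Finset.sum_const, Finset.card_univ, Fintype.card_fin,
    nsmul_eq_mul] at hs
  push_cast at hs
  have hpos : (0 : ℝ) < n + 1 := by positivity
  refine le_of_mul_le_mul_left ?_ hpos
  linarith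

theorem convexHull_subset_closedBall (h : IsRegularFrame u R D) (g : V n) :
    convexHull ℝ (Set.range fun i => g + u i) ⊆ Metric.closedBall g R := by
  refine convexHull_min ?_ (convex_closedBall _ _)
  rintro _ ⟨i, rfl⟩
  simp [h.norm_eq]

theorem circum_eq (h : IsRegularFrame u R D) (g : V n) :
    circum (euclBall n) (convexHull ℝ (Set.range fun i => g + u i)) = R := by
  refine IsLeast.csInf_eq ⟨⟨h.R_pos, g, ?_⟩, ?_⟩
  · rw [vadd_smul_euclBall _ h.R_pos.le]
    exact h.convexHull_subset_closedBall g
  · rintro ρ ⟨hρ, c, hc⟩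
    rw [vadd_smul_euclBall _ hρ.le] at hc
    have h1 := h.sq_add_le hc
    exact (sq_le_sq₀ h.R_pos.le hρ.le).1 (by linarith [sq_nonneg ‖g - c‖])

theorem mdiam_eq (h : IsRegularFrame u R D) (hn : 2 ≤ n) (g : V n) :
    mdiam (euclBall n) (convexHull ℝ (Set.range fun i => g + u i)) = D := by
  have h01 : (0 : Fin (n + 1)) ≠ Fin.last n := by
    intro h
    have := congrArg Fin.val h
    simp at this
    omega
  refine IsGreatest.csSup_eq ⟨⟨_, subset_convexHull ℝ _ ⟨0, rfl⟩, _,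
    subset_convexHull ℝ _ ⟨Fin.last n, rfl⟩, ?_⟩, ?_⟩
  · rw [gauge_euclBall, add_sub_add_left_eq_sub, h.norm_sub _ _ h01]
  · rintro _ ⟨x, hx, y, hy, rfl⟩
    obtain ⟨_, ⟨i, rfl⟩, _, ⟨j, rfl⟩, hij⟩ := convexHull_exists_dist_ge2 hx hy
    rw [gauge_euclBall, ← dist_eq_norm]
    refine hij.trans ?_
    rw [dist_add_left, dist_eq_norm]
    rcases eq_or_ne i j with rfl | hne
    · simpa using h.D_pos.le
    · exact (h.norm_sub i j hne).le

theorem isSandwiched_pseudoCompletion (h : IsRegularFrame u R D) (hn : 2 ≤ n) (g : V n) :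
    IsSandwiched u (D - R) R g
      (pseudoCompletion (euclBall n) (convexHull ℝ (Set.range fun i => g + u i)) g) := by
  have hr : 0 ≤ D - R := by linarith [h.R_lt_D hn]
  rw [pseudoCompletion, h.mdiam_eq hn, h.circum_eq, vadd_smul_euclBall _ hr,
    convexHull_convexHull_union_left]
  refine ⟨Set.subset_union_right.trans (subset_convexHull ℝ _), ?_,
    fun i => subset_convexHull ℝ _ (Or.inl ⟨i, rfl⟩), fun x hx i => ?_⟩
  · refine convexHull_min (Set.union_subset ((subset_convexHull ℝ _).trans
      (h.convexHull_subset_closedBall g)) (Metric.closedBall_subset_closedBall (h.D_sub_R_le hn)))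
      (convex_closedBall _ _)
  · have hconv : Convex ℝ {x : V n | -((D - R) * R) ≤ inner ℝ (x - g) (u i)} := by
      intro x hx y hy s t hs ht hst
      have h1 : s • x + t • y - g = s • (x - g) + t • (y - g) := by
        have : g = (s + t) • g := by rw [hst, one_smul]
        nth_rewrite 1 [this]
        module
      simp only [Set.mem_ofPred_eq] at hx hy ⊢
      rw [h1, inner_add_left, inner_smul_left, inner_smul_left, conj_trivial, conj_trivial]
      have h2 : (s + t) * -((D - R) * R) = -((D - R) * R) := by rw [hst, one_mul]
      linarith [mul_le_mul_of_nonneg_left hx hs, mul_le_mul_of_nonneg_left hy ht]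
    refine convexHull_min (Set.union_subset ?_ ?_) hconv hx
    · rintro _ ⟨j, rfl⟩
      simp only [Set.mem_ofPred_eq, add_sub_cancel_left]
      have hn' : (0 : ℝ) < n := by exact_mod_cast (by omega : 0 < n)
      refine le_of_mul_le_mul_left ?_ hn'
      rw [h.inner_eq]
      have h1 := mul_le_mul_of_nonneg_right (h.R_le_mul hn) h.R_pos.le
      have h2 : 0 ≤ (n + 1) * R ^ 2 * (if j = i then (1 : ℝ) else 0) := by
        split_ifs <;> positivity
      nlinarith
    · intro z hz
      rw [mem_closedBall_iff_norm] at hz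
      have h1 := abs_real_inner_le_norm (z - g) (u i)
      rw [h.norm_eq] at h1
      have h2 := mul_le_mul_of_nonneg_right hz h.R_pos.le
      simp only [Set.mem_ofPred_eq]
      linarith [(abs_le.1 h1).1]

end IsRegularFrame

theorem IsConvexBody.norm_sub_le_mdiam {n : ℕ} {K : Set (V n)} (hK : IsConvexBody K) {x y : V n}
    (hx : x ∈ K) (hy : y ∈ K) : ‖x - y‖ ≤ mdiam (euclBall n) K := by
  obtain ⟨C, hC⟩ := Metric.isBounded_iff.1 hK.2.1.isBounded
  refine le_csSup ⟨C, ?_⟩ ⟨x, hx, y, hy, (gauge_euclBall _).symm⟩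
  rintro _ ⟨a, ha, b, hb, rfl⟩
  rw [gauge_euclBall, ← dist_eq_norm]
  exact hC ha hb

theorem IsCompleteBody.mem_of_norm_sub_le {n : ℕ} {K : Set (V n)}
    (hK : IsCompleteBody (euclBall n) K) {x : V n}
    (hx : ∀ y ∈ K, ‖x - y‖ ≤ mdiam (euclBall n) K) : x ∈ K := by
  by_contra hxK
  refine (hK.2 x hxK).not_ge (csSup_le ⟨_, x, by simp, x, by simp, rfl⟩ ?_)
  have h0 : 0 ≤ mdiam (euclBall n) K := by
    obtain ⟨y, hy⟩ := hK.1.2.2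
    exact (norm_nonneg _).trans (hx y (interior_subset hy))
  rintro _ ⟨a, ha, b, hb, rfl⟩
  rw [gauge_euclBall]
  rcases ha with ha | rfl <;> rcases hb with hb | rfl
  · exact hK.1.norm_sub_le_mdiam ha hb
  · rw [norm_sub_rev]
    exact hx a ha
  · exact hx b hb
  · simpa using h0

theorem IsRegularFrame.isSandwiched_completion {n : ℕ} {u : Fin (n + 1) → V n} {R D : ℝ}
    (h : IsRegularFrame u R D) (hn : 2 ≤ n) {g : V n} {K : Set (V n)}
    (hK : IsCompletionOf (euclBall n) K (convexHull ℝ (Set.range fun i => g + u i))) :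
    IsSandwiched u (D - R) R g K := by
  obtain ⟨hcomp, hsub, hdiam⟩ := hK
  rw [h.mdiam_eq hn] at hdiam
  have hmem : ∀ i, g + u i ∈ K := fun i => hsub (subset_convexHull ℝ _ ⟨i, rfl⟩)
  have hdist : ∀ x ∈ K, ∀ i, ‖x - g - u i‖ ≤ D := by
    intro x hx i
    rw [sub_sub, ← hdiam]
    exact hcomp.1.norm_sub_le_mdiam hx (hmem i)
  have hball : K ⊆ Metric.closedBall g R := fun x hx =>
    mem_closedBall_iff_norm.2 (h.norm_le (by omega) (hdist x hx))
  refine ⟨fun x hx => hcomp.mem_of_norm_sub_le fun y hy => ?_, hball, hmem, fun x hx i => ?_⟩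
  · have h1 := norm_sub_le_norm_sub_add_norm_sub x g y
    have h2 := mem_closedBall_iff_norm.1 hx
    have h3 := mem_closedBall_iff_norm'.1 (hball hy)
    rw [hdiam]
    linarith
  · have h1 := abs_real_inner_le_norm (x - g - u i) (u i)
    rw [inner_sub_left, real_inner_self_eq_norm_sq, h.norm_eq] at h1
    have h2 := mul_le_mul_of_nonneg_right (hdist x hx i) h.R_pos.le
    nlinarith [(abs_le.1 h1).1]

/-- The Minkowski asymmetry fails Grünbaum's equality property (B):
there are non-symmetric, non-similar `K`, `L` with
`s(K+L) = max{s(K),s(L)}`; concretely `K = T⁺`, `L = T*` for a regular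
simplex `T`. -/
theorem stmt15 {n : ℕ} (hn : 2 ≤ n) :
    (∃ K L : Set (V n), IsConvexBody K ∧ IsConvexBody L ∧
      asym (K + L) = max (asym K) (asym L) ∧
      ¬(∃ c : V n, -K = c +ᵥ K) ∧ ¬(∃ c : V n, -L = c +ᵥ L) ∧
      ¬(∃ (ρ : ℝ) (x : V n), 0 < ρ ∧ L = x +ᵥ ρ • K)) ∧
    (∀ (T Tstar : Set (V n)) (c : V n), IsRegularSimplex T →
      T ⊆ c +ᵥ circum (euclBall n) T • euclBall n →
      IsCompletionOf (euclBall n) Tstar T →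
      pseudoCompletion (euclBall n) T c ≠ Tstar →
      asym (pseudoCompletion (euclBall n) T c + Tstar) =
        asym (pseudoCompletion (euclBall n) T c) ∧
      asym (pseudoCompletion (euclBall n) T c) = asym Tstar) := by
  refine ⟨exists_asym_add_eq_max hn, ?_⟩
  intro T Tstar c hT hTc hcomp _
  obtain ⟨g, u, R, D, h, rfl⟩ := hT.exists_frame hn
  rw [h.circum_eq, vadd_smul_euclBall _ h.R_pos.le] at hTc
  have hgc : g = c := by
    have h1 := h.sq_add_le hTc
    rw [← sub_eq_zero, ← norm_eq_zero, ← sq_eq_zero_iff]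
    linarith [sq_nonneg ‖g - c‖]
  subst hgc
  have hr : 0 < D - R := sub_pos.2 (h.R_lt_D hn)
  have hK := h.isSandwiched_pseudoCompletion hn g
  have hL := h.isSandwiched_completion hn hcomp
  rw [hK.asym_add hL hr h.R_pos h.sum_eq h.norm_eq, hK.asym_eq hr h.R_pos h.sum_eq h.norm_eq,
    hL.asym_eq hr h.R_pos h.sum_eq h.norm_eq]
  exact ⟨rfl, rfl⟩
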